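/- Let r be an odd prime and let ζ ∈ ℂ be a primitive 8r-th root of unity. Then the following identity of roots of unity holds: −ζ^(−(6 + r(2r+1))) = ζ^(r²) · ζ^(−(1+r²)(6 + r(r+1)/2)), where r(r+1)/2 is an integer and negative exponents denote inverses in ℂ. Equivalently, the integer congruence 4r − 6 − r(2r+1) ≡ r² − (1+r²)(6 + r(r+1)/2) (mod 8r) holds. (This is the content of the paper's Lemma stating κ_p = i_r(κ₂) j_r(κ_r) for p = 2r, where κ_p = −ζ_{4p}^(−6−p(p+1)/2), κ₂ = ζ₈, κ_r = ζ_{4r}^(−6−r(r+1)/2), i_r(ζ₈) = ζ_{4p}^(r²), and j_r sends ζ_{4r} to ζ_{4p}^(1+r²).) -/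

import Mathlib

/-- For `r` odd, the two exponents of the product formula agree modulo `8r`: their difference is
`(r(r+1)/2) * (7 + r²)`. -/
theorem kappa_exponent_modEq (r : ℕ) (hodd : Odd r) :
    Int.ModEq (8 * (r : ℤ))
      (4 * (r : ℤ) - 6 - (r : ℤ) * (2 * (r : ℤ) + 1))
      ((r : ℤ) ^ 2 - (1 + (r : ℤ) ^ 2) * (6 + ((r * (r + 1) / 2 : ℕ) : ℤ))) := by
  obtain ⟨k, rfl⟩ := hodd
  have hT : (2 * k + 1) * (2 * k + 1 + 1) / 2 = (2 * k + 1) * (k + 1) :=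
    Nat.div_eq_of_eq_mul_left two_pos (by ring)
  obtain ⟨m, hm⟩ := Int.even_mul_succ_self (k : ℤ)
  refine (Int.modEq_iff_dvd.2 ⟨((k : ℤ) + 1) * (1 + m), ?_⟩).symm
  rw [hT]
  push_cast
  linear_combination 4 * (2 * (k : ℤ) + 1) * (k + 1) * hm

/-- The `n`-th power of a primitive `2n`-th root of unity is `-1`. -/
theorem IsPrimitiveRoot.pow_half_eq_neg_one {R : Type*} [CommRing R] [IsDomain R] {ζ : R} {n : ℕ}
    (hn : 0 < n) (hζ : IsPrimitiveRoot ζ (2 * n)) : ζ ^ n = -1 :=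
  (hζ.pow (by positivity) (mul_comm 2 n)).eq_neg_one_of_two_right

/-- Let `r` be an odd prime and `ζ ∈ ℂ` a primitive `8r`-th root of
unity.  Then `−ζ^(−(6 + r(2r+1))) = ζ^(r²) · ζ^(−(1+r²)(6 + r(r+1)/2))`
(the identity `κ_p = i_r(κ₂) j_r(κ_r)` for `p = 2r`), and equivalently the integer
congruence `4r − 6 − r(2r+1) ≡ r² − (1+r²)(6 + r(r+1)/2) (mod 8r)` holds. -/
theorem kappa_product_formula (r : ℕ) (hr : r.Prime) (hodd : Odd r)
    (ζ : ℂ) (hζ : IsPrimitiveRoot ζ (8 * r)) :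
    (-(ζ ^ (-(6 + (r : ℤ) * (2 * (r : ℤ) + 1))))
        = ζ ^ ((r : ℤ) ^ 2)
          * ζ ^ (-((1 + (r : ℤ) ^ 2) * (6 + ((r * (r + 1) / 2 : ℕ) : ℤ))))) ∧
    Int.ModEq (8 * (r : ℤ))
      (4 * (r : ℤ) - 6 - (r : ℤ) * (2 * (r : ℤ) + 1))
      ((r : ℤ) ^ 2 - (1 + (r : ℤ) ^ 2) * (6 + ((r * (r + 1) / 2 : ℕ) : ℤ))) := by
  have hmod := kappa_exponent_modEq r hodd
  refine ⟨?_, hmod⟩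
  have hζ0 : ζ ≠ 0 := hζ.ne_zero (by simp [hr.ne_zero])
  have hneg : ζ ^ (4 * (r : ℤ)) = -1 := by
    have hζ' : IsPrimitiveRoot ζ (2 * (4 * r)) := by convert hζ using 1; ring
    exact_mod_cast hζ'.pow_half_eq_neg_one (by have := hr.pos; positivity)
  rw [← neg_one_mul, ← hneg, ← zpow_add₀ hζ0, ← zpow_add₀ hζ0, ← div_eq_one_iff_eq
    (zpow_ne_zero _ hζ0), ← zpow_sub₀ hζ0, hζ.zpow_eq_one_iff_dvd]
  convert hmod.symm.dvd using 1
  · push_cast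
    rfl
  · ring
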